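/- Define the anchored Chern–Finsler nonlinear connection coefficients N^β_α := ρ^k_α·N^β_k = h^{σ̄β}·ρ^k_α·∂_k∂̇_σ̄ F on U × (ℂᵐ \ {0}), and correspondingly Ñ^β_α := ρ̃^k_α·Ñ^β_k from F̃ on Ũ × (ℂᵐ \ {0}). Then for every (z,u) ∈ U × (ℂᵐ \ {0}) and all 1 ≤ α, γ ≤ m: M^β_α(z)·Ñ^γ_β(φ(z), M(z)u) = M^γ_β(z)·N^β_α(z,u) − ρ^k_α(z)·(∂M^γ_β/∂z^k)(z)·u^β. (This is the transformation law showing that the functions N^β_α determine a nonlinear connection, the Chern–Finsler nonlinear connection of the Lie algebroid.) -/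

import Mathlib

open Complex BigOperators

/-- Wirtinger derivative `∂_k g` in the base direction, for `g : ℂⁿ × ℂᵐ → ℂ`,
defined through the real Fréchet derivative. -/
noncomputable def wz {n m : ℕ} (g : (Fin n → ℂ) × (Fin m → ℂ) → ℂ) (k : Fin n)
    (p : (Fin n → ℂ) × (Fin m → ℂ)) : ℂ :=
  (1/2) * (fderiv ℝ g p (Pi.single k 1, 0)
    - Complex.I * fderiv ℝ g p (Pi.single k Complex.I, 0))

/-- Wirtinger derivative `∂̇_α g` in the fibre direction. -/
noncomputable def wu {n m : ℕ} (g : (Fin n → ℂ) × (Fin m → ℂ) → ℂ) (α : Fin m)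
    (p : (Fin n → ℂ) × (Fin m → ℂ)) : ℂ :=
  (1/2) * (fderiv ℝ g p (0, Pi.single α 1)
    - Complex.I * fderiv ℝ g p (0, Pi.single α Complex.I))

/-- Conjugate Wirtinger derivative `∂̇_ᾱ g` in the fibre direction. -/
noncomputable def wubar {n m : ℕ} (g : (Fin n → ℂ) × (Fin m → ℂ) → ℂ) (α : Fin m)
    (p : (Fin n → ℂ) × (Fin m → ℂ)) : ℂ :=
  (1/2) * (fderiv ℝ g p (0, Pi.single α 1)
    + Complex.I * fderiv ℝ g p (0, Pi.single α Complex.I))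

/-- The Levi metric tensor `h_{αβ̄} = ∂̇_α ∂̇_β̄ F` of a Finsler function `F`. -/
noncomputable def hmet {n m : ℕ} (F : (Fin n → ℂ) × (Fin m → ℂ) → ℝ) (α β : Fin m)
    (p : (Fin n → ℂ) × (Fin m → ℂ)) : ℂ :=
  wu (wubar (fun q => (F q : ℂ)) β) α p

/-- The Chern–Finsler nonlinear connection coefficients `N^β_k = h^{σ̄β}·∂_k ∂̇_σ̄ F`,
where `hinv σ β = h^{σ̄β}` are the entries of the inverse of `(h_{ασ̄})`. -/
noncomputable def Ncf {n m : ℕ} (F : (Fin n → ℂ) × (Fin m → ℂ) → ℝ)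
    (hinv : Fin m → Fin m → (Fin n → ℂ) × (Fin m → ℂ) → ℂ) (β : Fin m) (k : Fin n)
    (p : (Fin n → ℂ) × (Fin m → ℂ)) : ℂ :=
  ∑ σ, hinv σ β p * wz (wubar (fun q => (F q : ℂ)) σ) k p

/-- The horizontal derivative `δ_k g = ∂_k g − N^β_k·∂̇_β g`. -/
noncomputable def deltak {n m : ℕ} (F : (Fin n → ℂ) × (Fin m → ℂ) → ℝ)
    (hinv : Fin m → Fin m → (Fin n → ℂ) × (Fin m → ℂ) → ℂ)
    (g : (Fin n → ℂ) × (Fin m → ℂ) → ℂ) (k : Fin n)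
    (p : (Fin n → ℂ) × (Fin m → ℂ)) : ℂ :=
  wz g k p - ∑ β, Ncf F hinv β k p * wu g β p

/-- The anchored nonlinear connection coefficients `N^γ_β = ρ^k_β·N^γ_k`. -/
noncomputable def Nanch {n m : ℕ} (F : (Fin n → ℂ) × (Fin m → ℂ) → ℝ)
    (hinv : Fin m → Fin m → (Fin n → ℂ) × (Fin m → ℂ) → ℂ)
    (ρ : Fin n → Fin m → (Fin n → ℂ) → ℂ) (γ β : Fin m)
    (p : (Fin n → ℂ) × (Fin m → ℂ)) : ℂ :=
  ∑ k, ρ k β p.1 * Ncf F hinv γ k p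

/-- The anchored horizontal derivative `δ_β g = ρ^k_β·δ_k g`. -/
noncomputable def delanch {n m : ℕ} (F : (Fin n → ℂ) × (Fin m → ℂ) → ℝ)
    (hinv : Fin m → Fin m → (Fin n → ℂ) × (Fin m → ℂ) → ℂ)
    (ρ : Fin n → Fin m → (Fin n → ℂ) → ℂ)
    (g : (Fin n → ℂ) × (Fin m → ℂ) → ℂ) (β : Fin m)
    (p : (Fin n → ℂ) × (Fin m → ℂ)) : ℂ :=
  ∑ k, ρ k β p.1 * deltak F hinv g k p

/-- Wirtinger derivative `∂_h g` for a function of the base variable only. -/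
noncomputable def wz1 {n : ℕ} (g : (Fin n → ℂ) → ℂ) (h : Fin n) (z : Fin n → ℂ) : ℂ :=
  (1/2) * (fderiv ℝ g z (Pi.single h 1)
    - Complex.I * fderiv ℝ g z (Pi.single h Complex.I))

section WirtingerParts

variable {E : Type*} [NormedAddCommGroup E] [NormedSpace ℝ E] [NormedSpace ℂ E]
  [IsScalarTower ℝ ℂ E]

lemma ContinuousLinearMap.map_complex_smul (T : E →L[ℝ] ℂ) (c : ℂ) (v : E) :
    T (c • v) = c.re * T v + c.im * T (I • v) := by
  have h : c • v = c.re • v + c.im • (I • v) := by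
    conv_lhs => rw [← Complex.re_add_im c]
    rw [add_smul, mul_smul, ← Complex.coe_algebraMap, algebraMap_smul, algebraMap_smul]
  rw [h, map_add, map_smul, map_smul, Complex.real_smul, Complex.real_smul]

/-- The complex-linear part of a real-linear functional. -/
noncomputable def holPart (T : E →L[ℝ] ℂ) : E →ₗ[ℂ] ℂ where
  toFun v := (1 / 2) * (T v - I * T (I • v))
  map_add' v w := by simp only [smul_add, map_add]; ring
  map_smul' c v := by
    have h : I • c • v = (I * c) • v := smul_smul _ _ _
    rw [h, T.map_complex_smul c, T.map_complex_smul (I * c)]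
    simp only [Complex.mul_re, Complex.mul_im, Complex.I_re, Complex.I_im, RingHom.id_apply,
      smul_eq_mul]
    conv_rhs => rw [← Complex.re_add_im c]
    push_cast
    linear_combination (1 / 2 * c.im * T (I • v)) * Complex.I_sq

/-- The conjugate-linear part of a real-linear functional. -/
noncomputable def antiholPart (T : E →L[ℝ] ℂ) : E →ₛₗ[starRingEnd ℂ] ℂ where
  toFun v := (1 / 2) * (T v + I * T (I • v))
  map_add' v w := by simp only [smul_add, map_add]; ring
  map_smul' c v := by
    have h : I • c • v = (I * c) • v := smul_smul _ _ _
    have hc : (starRingEnd ℂ) c = c.re - c.im * I := by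
      apply Complex.ext <;> simp
    rw [h, T.map_complex_smul c, T.map_complex_smul (I * c), hc]
    simp only [Complex.mul_re, Complex.mul_im, Complex.I_re, Complex.I_im, smul_eq_mul]
    push_cast
    linear_combination (1 / 2 * c.im * T (I • v)) * Complex.I_sq

lemma holPart_apply (T : E →L[ℝ] ℂ) (v : E) :
    holPart T v = (1 / 2) * (T v - I * T (I • v)) := rfl

lemma antiholPart_apply (T : E →L[ℝ] ℂ) (v : E) :
    antiholPart T v = (1 / 2) * (T v + I * T (I • v)) := rfl

lemma holPart_restrictScalars (L : E →L[ℂ] ℂ) (v : E) :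
    holPart (L.restrictScalars ℝ) v = L v := by
  simp only [holPart_apply, ContinuousLinearMap.coe_restrictScalars', map_smul, smul_eq_mul]
  linear_combination (-1 / 2 * L v) * Complex.I_sq

end WirtingerParts

section Wirtinger

variable {n m : ℕ}

lemma wz_eq_holPart (g : (Fin n → ℂ) × (Fin m → ℂ) → ℂ) (k : Fin n)
    (p : (Fin n → ℂ) × (Fin m → ℂ)) :
    wz g k p = holPart (fderiv ℝ g p) (Pi.single k 1, 0) := by
  simp [wz, holPart_apply, ← Pi.single_smul]

lemma wu_eq_holPart (g : (Fin n → ℂ) × (Fin m → ℂ) → ℂ) (α : Fin m)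
    (p : (Fin n → ℂ) × (Fin m → ℂ)) :
    wu g α p = holPart (fderiv ℝ g p) (0, Pi.single α 1) := by
  simp [wu, holPart_apply, ← Pi.single_smul]

lemma wubar_eq_antiholPart (g : (Fin n → ℂ) × (Fin m → ℂ) → ℂ) (α : Fin m)
    (p : (Fin n → ℂ) × (Fin m → ℂ)) :
    wubar g α p = antiholPart (fderiv ℝ g p) (0, Pi.single α 1) := by
  simp [wubar, antiholPart_apply, ← Pi.single_smul]

lemma wz1_eq_fderiv {g : (Fin n → ℂ) → ℂ} {z : Fin n → ℂ} (hg : DifferentiableAt ℂ g z)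
    (h : Fin n) : wz1 g h z = fderiv ℂ g z (Pi.single h 1) := by
  rw [← holPart_restrictScalars, ← hg.fderiv_restrictScalars ℝ]
  simp [wz1, holPart_apply, ← Pi.single_smul]

lemma prod_pi_eq_sum (v : (Fin n → ℂ) × (Fin m → ℂ)) :
    v = ∑ k, v.1 k • ((Pi.single k 1, 0) : (Fin n → ℂ) × (Fin m → ℂ))
      + ∑ α, v.2 α • ((0, Pi.single α 1) : (Fin n → ℂ) × (Fin m → ℂ)) := by
  ext i <;> simp [Prod.fst_sum, Prod.snd_sum, Finset.sum_apply, Pi.single_apply]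

lemma holPart_fderiv_eq_sum (g : (Fin n → ℂ) × (Fin m → ℂ) → ℂ)
    (p v : (Fin n → ℂ) × (Fin m → ℂ)) :
    holPart (fderiv ℝ g p) v = ∑ k, v.1 k * wz g k p + ∑ α, v.2 α * wu g α p := by
  conv_lhs => rw [prod_pi_eq_sum v]
  simp only [map_add, map_sum, map_smul, smul_eq_mul, wz_eq_holPart, wu_eq_holPart]

lemma antiholPart_fderiv_eq_sum (g : (Fin n → ℂ) × (Fin m → ℂ) → ℂ)
    (p v : (Fin n → ℂ) × (Fin m → ℂ)) (hv : v.1 = 0) :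
    antiholPart (fderiv ℝ g p) v = ∑ α, (starRingEnd ℂ) (v.2 α) * wubar g α p := by
  conv_lhs => rw [prod_pi_eq_sum v]
  simp only [hv, map_sum, LinearMap.map_smulₛₗ, wubar_eq_antiholPart, Pi.zero_apply,
    zero_smul, Finset.sum_const_zero, zero_add, smul_eq_mul]

/-- The holomorphic change of coordinates `(z, u) ↦ (φ(z), M(z)u)`. -/
def bundleChange (φ : (Fin n → ℂ) → (Fin n → ℂ)) (M : (Fin n → ℂ) → Fin m → Fin m → ℂ)
    (p : (Fin n → ℂ) × (Fin m → ℂ)) : (Fin n → ℂ) × (Fin m → ℂ) :=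
  (φ p.1, fun δ => ∑ β, M p.1 δ β * p.2 β)

variable {φ : (Fin n → ℂ) → (Fin n → ℂ)} {M : (Fin n → ℂ) → Fin m → Fin m → ℂ}
  {p : (Fin n → ℂ) × (Fin m → ℂ)}

lemma exists_hasFDerivAt_bundleChange (hφ : ∀ k, DifferentiableAt ℂ (fun z => φ z k) p.1)
    (hM : ∀ α β, DifferentiableAt ℂ (fun z => M z α β) p.1) :
    ∃ L : (Fin n → ℂ) × (Fin m → ℂ) →L[ℂ] (Fin n → ℂ) × (Fin m → ℂ),
      HasFDerivAt (bundleChange φ M) L p ∧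
      (∀ k, L (Pi.single k 1, 0) = (fun h => wz1 (fun z => φ z h) k p.1,
        fun δ => ∑ β, wz1 (fun z => M z δ β) k p.1 * p.2 β)) ∧
      ∀ σ, L (0, Pi.single σ 1) = (0, fun δ => M p.1 δ σ) := by
  refine ⟨ContinuousLinearMap.prod
    (ContinuousLinearMap.pi fun h => (fderiv ℂ (fun z => φ z h) p.1).comp
      (ContinuousLinearMap.fst ℂ _ _))
    (ContinuousLinearMap.pi fun δ => ∑ β, (M p.1 δ β •
      ((ContinuousLinearMap.proj β).comp (ContinuousLinearMap.snd ℂ _ _)) +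
      p.2 β • (fderiv ℂ (fun z => M z δ β) p.1).comp (ContinuousLinearMap.fst ℂ _ _))),
    ?_, ?_, ?_⟩
  · refine HasFDerivAt.prodMk ?_ ?_
    · rw [hasFDerivAt_pi]
      exact fun h => (hφ h).hasFDerivAt.comp p hasFDerivAt_fst
    · rw [hasFDerivAt_pi]
      intro δ
      refine HasFDerivAt.fun_sum fun β _ => ?_
      exact ((hM δ β).hasFDerivAt.comp p hasFDerivAt_fst).mul
        ((ContinuousLinearMap.proj (R := ℂ) (φ := fun _ : Fin m => ℂ) β).hasFDerivAt.comp p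
          hasFDerivAt_snd)
  · intro k
    ext i
    · simp [wz1_eq_fderiv (hφ i)]
    · simp [wz1_eq_fderiv (hM i _), mul_comm]
  · intro σ
    ext i
    · simp
    · simp [Pi.single_apply]

lemma fderiv_comp_holomorphic {g : (Fin n → ℂ) × (Fin m → ℂ) → ℂ}
    {Φ : (Fin n → ℂ) × (Fin m → ℂ) → (Fin n → ℂ) × (Fin m → ℂ)}
    {L : (Fin n → ℂ) × (Fin m → ℂ) →L[ℂ] (Fin n → ℂ) × (Fin m → ℂ)}
    (hg : DifferentiableAt ℝ g (Φ p)) (hΦ : HasFDerivAt Φ L p) :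
    HasFDerivAt (fun q => g (Φ q)) ((fderiv ℝ g (Φ p)).comp (L.restrictScalars ℝ)) p :=
  hg.hasFDerivAt.comp p (hΦ.restrictScalars ℝ)

lemma wubar_bundleChange {g : (Fin n → ℂ) × (Fin m → ℂ) → ℂ}
    (hφ : ∀ k, DifferentiableAt ℂ (fun z => φ z k) p.1)
    (hM : ∀ α β, DifferentiableAt ℂ (fun z => M z α β) p.1)
    (hg : DifferentiableAt ℝ g (bundleChange φ M p)) (σ : Fin m) :
    wubar (fun q => g (bundleChange φ M q)) σ p
      = ∑ τ, (starRingEnd ℂ) (M p.1 τ σ) * wubar g τ (bundleChange φ M p) := by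
  obtain ⟨L, hL, -, hLu⟩ := exists_hasFDerivAt_bundleChange hφ hM
  have key : antiholPart ((fderiv ℝ g (bundleChange φ M p)).comp (L.restrictScalars ℝ))
      (0, Pi.single σ 1)
      = antiholPart (fderiv ℝ g (bundleChange φ M p)) (L (0, Pi.single σ 1)) := by
    simp only [antiholPart_apply, ContinuousLinearMap.comp_apply,
      ContinuousLinearMap.coe_restrictScalars', map_smul]
  rw [wubar_eq_antiholPart, (fderiv_comp_holomorphic hg hL).fderiv, key, hLu,
    antiholPart_fderiv_eq_sum _ _ _ rfl]

/-- The conjugate of a holomorphic coefficient is constant for the holomorphic part of the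
derivative. -/
lemma holPart_fderiv_sum_conj_mul {ι : Type*} [Fintype ι]
    {a G : ι → (Fin n → ℂ) × (Fin m → ℂ) → ℂ} (ha : ∀ τ, DifferentiableAt ℂ (a τ) p)
    (hG : ∀ τ, DifferentiableAt ℝ (G τ) p) (v : (Fin n → ℂ) × (Fin m → ℂ)) :
    holPart (fderiv ℝ (fun q => ∑ τ, (starRingEnd ℂ) (a τ q) * G τ q) p) v
      = ∑ τ, (starRingEnd ℂ) (a τ p) * holPart (fderiv ℝ (G τ) p) v := by
  have hd : HasFDerivAt (fun q => ∑ τ, (starRingEnd ℂ) (a τ q) * G τ q)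
      (∑ τ, ((starRingEnd ℂ) (a τ p) • fderiv ℝ (G τ) p + G τ p •
        (Complex.conjCLE.toContinuousLinearMap.comp
          ((fderiv ℂ (a τ) p).restrictScalars ℝ)))) p := by
    refine HasFDerivAt.fun_sum fun τ _ => ?_
    exact (Complex.conjCLE.toContinuousLinearMap.hasFDerivAt.comp p
      ((ha τ).hasFDerivAt.restrictScalars ℝ)).mul (hG τ).hasFDerivAt
  rw [hd.fderiv]
  simp only [holPart_apply, sum_apply, add_apply,
    smul_apply, ContinuousLinearMap.comp_apply,
    ContinuousLinearMap.coe_restrictScalars', map_smul, smul_eq_mul,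
    ContinuousLinearEquiv.coe_coe, Complex.conjCLE_apply, map_mul, Complex.conj_I,
    Finset.mul_sum]
  rw [← Finset.sum_sub_distrib, Finset.mul_sum]
  refine Finset.sum_congr rfl fun τ _ => ?_
  linear_combination (1 / 2 * G τ p * (starRingEnd ℂ) (fderiv ℂ (a τ) p v)) * Complex.I_sq

lemma holPart_fderiv_wubar_bundleChange {U : Set (Fin n → ℂ)} (hU : IsOpen U)
    (hφ : ∀ k, DifferentiableOn ℂ (fun z => φ z k) U)
    (hM : ∀ α β, DifferentiableOn ℂ (fun z => M z α β) U)
    {F Ft : (Fin n → ℂ) × (Fin m → ℂ) → ℝ}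
    (hFt : ∀ q : (Fin n → ℂ) × (Fin m → ℂ), q.1 ∈ U → q.2 ≠ 0 →
      ContDiffAt ℝ (⊤ : ℕ∞) Ft (bundleChange φ M q))
    (hFrel : ∀ q : (Fin n → ℂ) × (Fin m → ℂ), q.1 ∈ U → q.2 ≠ 0 →
      Ft (bundleChange φ M q) = F q)
    (hp : p.1 ∈ U) (hp0 : p.2 ≠ 0)
    {L : (Fin n → ℂ) × (Fin m → ℂ) →L[ℂ] (Fin n → ℂ) × (Fin m → ℂ)}
    (hL : HasFDerivAt (bundleChange φ M) L p) (σ : Fin m) (v : (Fin n → ℂ) × (Fin m → ℂ)) :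
    holPart (fderiv ℝ (wubar (fun q => (F q : ℂ)) σ) p) v
      = ∑ τ, (starRingEnd ℂ) (M p.1 τ σ) *
        holPart (fderiv ℝ (wubar (fun q => (Ft q : ℂ)) τ) (bundleChange φ M p)) (L v) := by
  have hopen : IsOpen {q : (Fin n → ℂ) × (Fin m → ℂ) | q.1 ∈ U ∧ q.2 ≠ 0} :=
    (hU.preimage continuous_fst).inter (isOpen_ne.preimage continuous_snd)
  have hcast : ∀ q : (Fin n → ℂ) × (Fin m → ℂ), q.1 ∈ U → q.2 ≠ 0 →
      ContDiffAt ℝ (⊤ : ℕ∞) (fun x => (Ft x : ℂ)) (bundleChange φ M q) := fun q h h0 =>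
    Complex.ofRealCLM.contDiff.contDiffAt.comp _ (hFt q h h0)
  have hev : wubar (fun q => (F q : ℂ)) σ =ᶠ[nhds p] fun q =>
      ∑ τ, (starRingEnd ℂ) (M q.1 τ σ) *
        wubar (fun x => (Ft x : ℂ)) τ (bundleChange φ M q) := by
    filter_upwards [hopen.mem_nhds ⟨hp, hp0⟩] with q hq
    rw [← wubar_bundleChange (fun k => (hφ k).differentiableAt (hU.mem_nhds hq.1))
      (fun α β => (hM α β).differentiableAt (hU.mem_nhds hq.1))
      ((hcast q hq.1 hq.2).differentiableAt (by simp))]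
    have hloc : (fun q => (F q : ℂ)) =ᶠ[nhds q] fun x => (Ft (bundleChange φ M x) : ℂ) := by
      filter_upwards [hopen.mem_nhds hq] with x hx
      rw [hFrel x hx.1 hx.2]
    simp only [wubar, hloc.fderiv_eq]
  have hwd : ∀ τ, DifferentiableAt ℝ (wubar (fun x => (Ft x : ℂ)) τ) (bundleChange φ M p) := by
    intro τ
    have hdd : DifferentiableAt ℝ (fderiv ℝ (fun x => (Ft x : ℂ))) (bundleChange φ M p) :=
      ((hcast p hp hp0).fderiv_right (m := 1) (by norm_cast)).differentiableAt (by simp)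
    unfold wubar
    fun_prop
  rw [hev.fderiv_eq, holPart_fderiv_sum_conj_mul (a := fun τ q => M q.1 τ σ)
    (G := fun τ q => wubar (fun x => (Ft x : ℂ)) τ (bundleChange φ M q))
    (fun τ => DifferentiableAt.comp p ((hM τ σ).differentiableAt (hU.mem_nhds hp))
      differentiableAt_fst)
    (fun τ => (fderiv_comp_holomorphic (hwd τ) hL).differentiableAt)]
  refine Finset.sum_congr rfl fun τ _ => ?_
  rw [(fderiv_comp_holomorphic (hwd τ) hL).fderiv]
  simp only [holPart_apply, ContinuousLinearMap.comp_apply,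
    ContinuousLinearMap.coe_restrictScalars', map_smul]

end Wirtinger

/-- If a Hermitian-type form `H` and mixed derivatives `A` transform from `Ht` and `At` with an
inhomogeneous term `D`, then the coefficients `A * Hinv` transform as a connection. -/
lemma connection_transform {n m : Type*} [Fintype n] [Fintype m] [DecidableEq m]
    {H Hinv Ht Htinv P Q : Matrix m m ℂ} {A At D : Matrix n m ℂ} {J : Matrix n n ℂ}
    {R : Matrix m m ℂ} (hH : H * Hinv = 1) (hHt : Ht * Htinv = 1) (hQ : Q * R = 1)
    (hHP : H = P * Ht * Q) (hA : A = (J * At + D * Ht) * Q) :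
    A * Hinv * P = J * (At * Htinv) + D := by
  have h1 : Hinv * H = 1 := mul_eq_one_comm.mp hH
  have h2 : A * Hinv * (P * Ht * Q) = (J * At + D * Ht) * Q := by
    rw [← hHP, Matrix.mul_assoc, h1, Matrix.mul_one, hA]
  have h3 := congrArg (fun X => X * R * Htinv) h2
  simp only [Matrix.mul_assoc, hQ, Matrix.mul_one, hHt, Matrix.add_mul] at h3
  simpa [Matrix.mul_assoc] using h3

/-- transformation law of the anchored Chern–Finsler nonlinear connection
coefficients `N^β_α = ρ^k_α·N^β_k = h^{σ̄β}·ρ^k_α·∂_k∂̇_σ̄F` under a change of local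
chart `(φ, M)`:
`M^β_α(z)·Ñ^γ_β(φ(z), M(z)u) = M^γ_β(z)·N^β_α(z,u) − ρ^k_α(z)·(∂M^γ_β/∂z^k)(z)·u^β`,
showing they determine a nonlinear connection (the Chern–Finsler nonlinear connection
of the Lie algebroid). -/
theorem stmt12 {n m : ℕ} (U Ut : Set (Fin n → ℂ)) (hU : IsOpen U) (hUt : IsOpen Ut)
    -- the biholomorphism φ : U → Ũ with inverse ψ
    (φ ψ : (Fin n → ℂ) → (Fin n → ℂ))
    (hφ : ∀ k : Fin n, DifferentiableOn ℂ (fun z => φ z k) U)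
    (hψ : ∀ k : Fin n, DifferentiableOn ℂ (fun w => ψ w k) Ut)
    (hφm : Set.MapsTo φ U Ut) (hψm : Set.MapsTo ψ Ut U)
    (hψφ : ∀ z ∈ U, ψ (φ z) = z) (hφψ : ∀ w ∈ Ut, φ (ψ w) = w)
    -- the holomorphic matrix of change M with pointwise inverse W
    (M W : (Fin n → ℂ) → Fin m → Fin m → ℂ)
    (hM : ∀ α β : Fin m, DifferentiableOn ℂ (fun z => M z α β) U)
    (hMW : ∀ z ∈ U, ∀ α γ : Fin m,
      (∑ β, M z α β * W z β γ = if α = γ then 1 else 0)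
      ∧ (∑ β, W z α β * M z β γ = if α = γ then 1 else 0))
    -- anchor coefficients and their transformation law
    (ρ ρt : Fin n → Fin m → (Fin n → ℂ) → ℂ)
    (hρ : ∀ (k : Fin n) (α : Fin m), DifferentiableOn ℂ (ρ k α) U)
    (hρt : ∀ (k : Fin n) (α : Fin m), DifferentiableOn ℂ (ρt k α) Ut)
    (hρrel : ∀ z ∈ U, ∀ (k : Fin n) (α : Fin m),
      ρt k α (φ z) = ∑ β, ∑ h, W z β α * ρ h β z * wz1 (fun w => φ w k) h z)
    -- the Finsler function and its Levi metric on the initial chart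
    (F : (Fin n → ℂ) × (Fin m → ℂ) → ℝ)
    (hF : ContDiffOn ℝ (⊤ : ℕ∞) F {p : (Fin n → ℂ) × (Fin m → ℂ) | p.1 ∈ U ∧ p.2 ≠ 0})
    (hinv : Fin m → Fin m → (Fin n → ℂ) × (Fin m → ℂ) → ℂ)
    (hinv_spec : ∀ p ∈ {p : (Fin n → ℂ) × (Fin m → ℂ) | p.1 ∈ U ∧ p.2 ≠ 0},
      ∀ α γ : Fin m, ∑ β, hmet F α β p * hinv β γ p = if α = γ then 1 else 0)
    -- the transformed Finsler function and its Levi metric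
    (Ft : (Fin n → ℂ) × (Fin m → ℂ) → ℝ)
    (hFt : ContDiffOn ℝ (⊤ : ℕ∞) Ft {p : (Fin n → ℂ) × (Fin m → ℂ) | p.1 ∈ Ut ∧ p.2 ≠ 0})
    (htinv : Fin m → Fin m → (Fin n → ℂ) × (Fin m → ℂ) → ℂ)
    (htinv_spec : ∀ p ∈ {p : (Fin n → ℂ) × (Fin m → ℂ) | p.1 ∈ Ut ∧ p.2 ≠ 0},
      ∀ α γ : Fin m, ∑ β, hmet Ft α β p * htinv β γ p = if α = γ then 1 else 0)
    (hFrel : ∀ z ∈ U, ∀ u : Fin m → ℂ, u ≠ 0 →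
      Ft (φ z, fun δ => ∑ β, M z δ β * u β) = F (z, u)) :
    ∀ z ∈ U, ∀ u : Fin m → ℂ, u ≠ 0 → ∀ α γ : Fin m,
      (∑ β, M z β α * Nanch Ft htinv ρt γ β (φ z, fun δ => ∑ ε, M z δ ε * u ε))
        = (∑ β, M z γ β * Nanch F hinv ρ β α (z, u))
          - ∑ k, ∑ β, ρ k α z * wz1 (fun w => M w γ β) k z * u β := by
  intro z hz u hu α γ
  have hMu : ∀ z ∈ U, ∀ u : Fin m → ℂ, u ≠ 0 → (fun δ => ∑ β, M z δ β * u β) ≠ 0 := by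
    intro z hz u hu h0
    have hWM : Matrix.of (W z) * Matrix.of (M z) = 1 := by
      ext i j
      simpa [Matrix.mul_apply, Matrix.one_apply] using (hMW z hz i j).2
    apply hu
    have h0' : (Matrix.of (M z)).mulVec u = 0 := h0
    rw [← Matrix.one_mulVec u, ← hWM, ← Matrix.mulVec_mulVec, h0', Matrix.mulVec_zero]
  have hopent : IsOpen {p : (Fin n → ℂ) × (Fin m → ℂ) | p.1 ∈ Ut ∧ p.2 ≠ 0} :=
    (hUt.preimage continuous_fst).inter (isOpen_ne.preimage continuous_snd)
  have hmem : ∀ q : (Fin n → ℂ) × (Fin m → ℂ), q.1 ∈ U → q.2 ≠ 0 →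
      bundleChange φ M q ∈ {p : (Fin n → ℂ) × (Fin m → ℂ) | p.1 ∈ Ut ∧ p.2 ≠ 0} :=
    fun q h h0 => ⟨hφm h, hMu _ h _ h0⟩
  obtain ⟨L, hL, hLz, hLu⟩ := exists_hasFDerivAt_bundleChange (p := (z, u))
    (fun k => (hφ k).differentiableAt (hU.mem_nhds hz))
    (fun α β => (hM α β).differentiableAt (hU.mem_nhds hz))
  have key := holPart_fderiv_wubar_bundleChange (p := (z, u)) hU hφ hM (F := F) (Ft := Ft)
    (fun q h h0 => hFt.contDiffAt (hopent.mem_nhds (hmem q h h0)))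
    (fun q h h0 => hFrel q.1 h q.2 h0) hz hu hL
  change ∑ β, M z β α * Nanch Ft htinv ρt γ β (bundleChange φ M (z, u)) = _
  have hpt := hmem (z, u) hz hu
  have hpt1 : (bundleChange φ M (z, u)).1 = φ z := rfl
  generalize bundleChange φ M (z, u) = pt at key hpt hpt1 ⊢
  let J : Matrix (Fin n) (Fin n) ℂ := .of fun k h => wz1 (fun w => φ w h) k z
  let D : Matrix (Fin n) (Fin m) ℂ := .of fun k δ => ∑ β, wz1 (fun w => M w δ β) k z * u β
  have hconn := connection_transform
    (H := .of fun α β => hmet F α β (z, u)) (Hinv := .of fun α β => hinv α β (z, u))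
    (Ht := .of fun α β => hmet Ft α β pt) (Htinv := .of fun α β => htinv α β pt)
    (P := .of fun β δ => M z δ β) (Q := .of fun τ σ => (starRingEnd ℂ) (M z τ σ))
    (R := .of fun τ σ => (starRingEnd ℂ) (W z τ σ))
    (A := .of fun k σ => wz (wubar (fun q => (F q : ℂ)) σ) k (z, u))
    (At := .of fun k σ => wz (wubar (fun q => (Ft q : ℂ)) σ) k pt) (D := D) (J := J)
    (by
      ext i j
      simpa [Matrix.mul_apply, Matrix.one_apply] using hinv_spec (z, u) ⟨hz, hu⟩ i j)
    (by
      ext i j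
      simpa [Matrix.mul_apply, Matrix.one_apply] using htinv_spec pt hpt i j)
    (by
      ext i j
      have h := congrArg (starRingEnd ℂ) (hMW z hz i j).1
      simpa [Matrix.mul_apply, Matrix.one_apply, apply_ite (starRingEnd ℂ)] using h)
    (by
      ext i j
      simp only [Matrix.of_apply, hmet, wu_eq_holPart, key, hLu, Matrix.mul_apply]
      refine Finset.sum_congr rfl fun τ _ => ?_
      rw [mul_comm, holPart_fderiv_eq_sum]
      simp [wu_eq_holPart])
    (by
      ext k σ
      simp only [Matrix.of_apply, wz_eq_holPart, key, hLz, Matrix.mul_apply, Matrix.add_apply]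
      refine Finset.sum_congr rfl fun τ _ => ?_
      rw [mul_comm, holPart_fderiv_eq_sum]
      simp [J, D, hmet, wz_eq_holPart])
  have hN : ∀ k, ∑ β, M z γ β * Ncf F hinv β k (z, u)
      = ∑ h, wz1 (fun w => φ w h) k z * Ncf Ft htinv γ h pt
        + ∑ β, wz1 (fun w => M w γ β) k z * u β := by
    intro k
    have h := congrFun (congrFun hconn k) γ
    simpa [Matrix.mul_apply, J, D, Ncf, mul_comm] using h
  have hρM : ∀ h, ∑ β, M z β α * ρt h β (φ z)
      = ∑ k, ρ k α z * wz1 (fun w => φ w h) k z := by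
    intro h
    have hsum : ∀ ε, ∑ β, M z β α * W z ε β = if ε = α then 1 else 0 := fun ε => by
      rw [← (hMW z hz ε α).2]
      exact Finset.sum_congr rfl fun _ _ => mul_comm _ _
    calc ∑ β, M z β α * ρt h β (φ z)
        = ∑ ε, (∑ β, M z β α * W z ε β) * ∑ k, ρ k ε z * wz1 (fun w => φ w h) k z := by
          simp only [hρrel z hz, Finset.sum_mul]
          rw [Finset.sum_comm]
          refine Finset.sum_congr rfl fun β _ => ?_
          rw [Finset.mul_sum]
          refine Finset.sum_congr rfl fun ε _ => ?_
          simp only [Finset.mul_sum, mul_assoc]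
      _ = _ := by simp [hsum]
  calc ∑ β, M z β α * Nanch Ft htinv ρt γ β pt
      = ∑ h, (∑ β, M z β α * ρt h β (φ z)) * Ncf Ft htinv γ h pt := by
        simp only [Nanch, hpt1, Finset.mul_sum, Finset.sum_mul, mul_assoc]
        exact Finset.sum_comm
    _ = ∑ k, ρ k α z * ∑ h, wz1 (fun w => φ w h) k z * Ncf Ft htinv γ h pt := by
        simp only [hρM, Finset.mul_sum, Finset.sum_mul, mul_assoc]
        exact Finset.sum_comm
    _ = ∑ k, ρ k α z * (∑ β, M z γ β * Ncf F hinv β k (z, u)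
          - ∑ β, wz1 (fun w => M w γ β) k z * u β) := by
        simp only [hN, add_sub_cancel_right]
    _ = _ := by
        simp only [mul_sub, Finset.sum_sub_distrib, Nanch, Finset.mul_sum, mul_assoc]
        congr 1
        rw [Finset.sum_comm]
        exact Finset.sum_congr rfl fun _ _ => Finset.sum_congr rfl fun _ _ => mul_left_comm _ _ _
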